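/- arXiv:2411.02125 — 8 statements merged into one kernel-verified Lean document; each statement's English description precedes it below -/
import Mathlib

section
/- Let r be a read of length ℓ and 2 ≤ k ≤ ℓ. If r_1⋯r_{k−1} = r_{ℓ−k+2}⋯r_ℓ (the first and last (k−1)-mers of r coincide) and r_i ≠ r_1 for some index i (r is not a constant string), then there exists a read q of length ℓ with q ≠ r having the same k-mer profile as r. -/
/-- The DNA alphabet Σ = {A,C,T,G}, modeled as `Fin 4`. -/
abbrev Base := Fin 4

/-- `kmerCount k r x` is the number of indices `i ∈ {1,…,ℓ−k+1}` (0-indexed here)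
such that the length-`k` substring of `r` starting at position `i` equals `x`. -/
def kmerCount (k : ℕ) (r x : List Base) : ℕ :=
  ((List.range (r.length - k + 1)).filter (fun i => decide ((r.drop i).take k = x))).length

/-- `substr r i j` is the substring `r_i ⋯ r_j` of `r` (1-indexed, inclusive). -/
def substr (r : List Base) (i j : ℕ) : List Base :=
  (r.drop (i - 1)).take (j - i + 1)

/-- If the first and last (k−1)-mers of `r` coincide and `r` is not a constant string,
then there is a distinct read of the same length with the same `k`-mer profile. -/
theorem cond1_not_identifiable (k ℓ : ℕ) (hk : 2 ≤ k) (hkl : k ≤ ℓ)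
    (r : List Base) (hr : r.length = ℓ)
    (h1 : substr r 1 (k - 1) = substr r (ℓ - k + 2) ℓ)
    (h2 : ∃ i, 1 ≤ i ∧ i ≤ ℓ ∧ substr r i i ≠ substr r 1 1) :
    ∃ q : List Base, q.length = ℓ ∧ q ≠ r ∧
      (∀ x : List Base, kmerCount k q x = kmerCount k r x) := by
  obtain ⟨n, rfl⟩ : ∃ n, ℓ = n + k := ⟨ℓ - k, by omega⟩
  obtain ⟨m, rfl⟩ : ∃ m, k = m + 1 := ⟨k - 1, by omega⟩
  have hm : m < r.length := by omega
  have hper : r.drop (n + 1) = r.take m := by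
    unfold substr at h1
    have e1 : m + 1 - 1 - 1 + 1 = m := by omega
    have e2 : n + (m + 1) - (m + 1) + 2 - 1 = n + 1 := by omega
    have e3 : n + (m + 1) - (n + (m + 1) - (m + 1) + 2) + 1 = m := by omega
    rw [e1, e2, e3] at h1
    simp only [Nat.sub_self, List.drop_zero] at h1
    rw [h1, List.take_of_length_le]
    simp only [List.length_drop]
    omega
  have hql : (r.drop 1 ++ [r[m]]).length = n + (m + 1) := by
    simp only [List.length_append, List.length_drop, List.length_singleton]
    omega
  refine ⟨r.drop 1 ++ [r[m]], hql, ?_, ?_⟩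
  · intro hq
    have hstep : ∀ j (hj : j + 1 < r.length), r[j + 1] = r[j] := by
      intro j hj
      have h3 : (r.drop 1 ++ [r[m]])[j]? = r[j]? := by rw [hq]
      rw [List.getElem?_append_left (by simp only [List.length_drop]; omega),
        List.getElem?_drop, Nat.add_comm 1 j, List.getElem?_eq_getElem hj,
        List.getElem?_eq_getElem (by omega)] at h3
      exact Option.some.inj h3
    have hconst : ∀ j (hj : j < r.length), r[j] = r[0] := by
      intro j
      induction j with
      | zero => intro _; rfl
      | succ j ih => intro hj; rw [hstep j hj]; exact ih (by omega)
    obtain ⟨i, hi1, hi2, hne⟩ := h2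
    apply hne
    unfold substr
    have hi : i - 1 < r.length := by omega
    have h0 : 0 < r.length := by omega
    simp only [Nat.sub_self, Nat.zero_add]
    rw [List.drop_eq_getElem_cons hi, List.drop_eq_getElem_cons h0, hconst (i - 1) hi]
    simp
  · intro x
    unfold kmerCount
    rw [hql, hr]
    have e : n + (m + 1) - (m + 1) = n := by omega
    rw [e]
    simp only [← List.countP_eq_length_filter]
    conv_lhs => rw [List.range_succ]
    conv_rhs => rw [List.range_succ_eq_map]
    rw [List.countP_append, List.countP_singleton, List.countP_cons, List.countP_map]
    have hlast : ((r.drop 1 ++ [r[m]]).drop n).take (m + 1) = (r.drop 0).take (m + 1) := by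
      rw [List.drop_append_of_le_length (by simp only [List.length_drop]; omega),
        List.drop_drop, Nat.add_comm 1 n, hper, List.drop_zero, List.take_concat_get' r m hm,
        List.take_take, Nat.min_self]
    rw [hlast]
    congr 1
    apply List.countP_congr
    intro i hi
    have hi' : i < n := List.mem_range.mp hi
    have : ((r.drop 1 ++ [r[m]]).drop i).take (m + 1) = (r.drop (i + 1)).take (m + 1) := by
      rw [List.drop_append_of_le_length (by simp only [List.length_drop]; omega),
        List.drop_drop, Nat.add_comm 1 i,
        List.take_append_of_le_length (by simp only [List.length_drop]; omega)]
    simp only [Function.comp, this, Nat.succ_eq_add_one]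
end

section
/- Let r be a read of length ℓ and 2 ≤ k ≤ ℓ. Suppose r satisfies none of the following three conditions: (1) r_1⋯r_{k−1} = r_{ℓ−k+2}⋯r_ℓ and r_i ≠ r_1 for some index i; (2) there exist indices 1 ≤ i < g < j < h ≤ ℓ−k+2 such that r_i⋯r_{i+k−2} = r_j⋯r_{j+k−2} and r_g⋯r_{g+k−2} = r_h⋯r_{h+k−2} with r_{i+k−1}⋯r_{g−1} ≠ r_{j+k−1}⋯r_{h−1}; (3) there exist indices 1 ≤ i < j < h ≤ ℓ−k+2 such that r_i⋯r_{i+k−2} = r_j⋯r_{j+k−2} = r_h⋯r_{h+k−2} with r_{i+k−1}⋯r_{j−1} ≠ r_{j+k−1}⋯r_{h−1}. Then every read q of length ℓ having the same k-mer profile as r is equal to r. -/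
/-- Condition (1): the first and last (k−1)-mers of `r` coincide and `r` is not constant. -/
def Cond1 (k ℓ : ℕ) (r : List Base) : Prop :=
  substr r 1 (k - 1) = substr r (ℓ - k + 2) ℓ ∧
    ∃ i, 1 ≤ i ∧ i ≤ ℓ ∧ substr r i i ≠ substr r 1 1

/-- Condition (2). -/
def Cond2 (k ℓ : ℕ) (r : List Base) : Prop :=
  ∃ i g j h, 1 ≤ i ∧ i < g ∧ g < j ∧ j < h ∧ h ≤ ℓ - k + 2 ∧
    substr r i (i + k - 2) = substr r j (j + k - 2) ∧
    substr r g (g + k - 2) = substr r h (h + k - 2) ∧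
    substr r (i + k - 1) (g - 1) ≠ substr r (j + k - 1) (h - 1)

/-- Condition (3). -/
def Cond3 (k ℓ : ℕ) (r : List Base) : Prop :=
  ∃ i j h, 1 ≤ i ∧ i < j ∧ j < h ∧ h ≤ ℓ - k + 2 ∧
    substr r i (i + k - 2) = substr r j (j + k - 2) ∧
    substr r j (j + k - 2) = substr r h (h + k - 2) ∧
    substr r (i + k - 1) (j - 1) ≠ substr r (j + k - 1) (h - 1)

/-- Two windows agree iff they agree letter by letter. -/
lemma window_eq_iff (a b : List Base) (i j n : ℕ) :
    (a.drop i).take n = (b.drop j).take n ↔ ∀ x < n, a[i + x]? = b[j + x]? := by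
  constructor
  · intro h x hx
    have := congrArg (fun l : List Base => l[x]?) h
    simpa [List.getElem?_take, hx] using this
  · intro h
    apply List.ext_getElem?
    intro x
    by_cases hx : x < n
    · simpa [List.getElem?_take, hx] using h x hx
    · simp [hx]

/-- The list of consecutive pairs of a sequence. -/
def edges {α : Type*} (v : ℕ → α) (m : ℕ) : List (α × α) :=
  (List.range m).map (fun p => (v p, v (p + 1)))

lemma edges_balance {α : Type*} [DecidableEq α] (v : ℕ → α) (x : α) (m : ℕ) :
    ((edges v m).map Prod.fst).count x + (if v m = x then 1 else 0)
      = ((edges v m).map Prod.snd).count x + (if v 0 = x then 1 else 0) := by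
  induction m with
  | zero => simp [edges]
  | succ m ih =>
    simp only [edges, List.range_succ, List.map_append, List.count_append, List.map_cons,
      List.map_nil, List.count_singleton, beq_iff_eq] at ih ⊢
    omega

lemma start_eq {α : Type*} (u v : ℕ → α) (m : ℕ)
    (hp : (edges u m).Perm (edges v m)) (hne : v 0 ≠ v m) : u 0 = v 0 := by
  classical
  have h1 := edges_balance u (v 0) m
  have h2 := edges_balance v (v 0) m
  rw [(hp.map Prod.fst).count_eq, (hp.map Prod.snd).count_eq] at h1
  by_contra hu
  simp only [if_neg hu, if_neg hne.symm, if_true] at h1 h2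
  omega

lemma core {α : Type*} (u v : ℕ → α) (m : ℕ)
    (hp : (edges u m).Perm (edges v m)) (h0 : u 0 = v 0)
    (h2 : ∀ i g j h, i < g → g < j → j < h → h ≤ m → v i = v j → v g = v h →
      v (i + 1) = v (j + 1))
    (h3 : ∀ i j h, i < j → j < h → h ≤ m → v i = v j → v j = v h →
      v (i + 1) = v (j + 1)) :
    ∀ t, t ≤ m → ∀ p ≤ t, u p = v p := by
  intro t
  induction t with
  | zero => intro _ p hp; obtain rfl : p = 0 := by omega
            exact h0
  | succ t ih =>
    intro ht
    have ih := ih (by omega)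
    suffices hs : u (t + 1) = v (t + 1) by
      intro p hpt
      rcases Nat.lt_or_ge p (t + 1) with h | h
      · exact ih p (by omega)
      · obtain rfl : p = t + 1 := by omega
        exact hs
    by_contra hne
    -- suffix edges
    have hmem : ∀ e : α × α, (∃ p, t ≤ p ∧ p < m ∧ (u p, u (p + 1)) = e) ↔
        (∃ p, t ≤ p ∧ p < m ∧ (v p, v (p + 1)) = e) := by
      have hsplit : List.range m = List.range t ++ List.range' t (m - t) := by
        rw [List.range_eq_range', List.range_eq_range']
        have := List.range'_append (s := 0) (m := t) (n := m - t) (step := 1)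
        simp only [one_mul, zero_add] at this
        rw [this]; congr 1; omega
      have hpre : (List.range t).map (fun p => (u p, u (p + 1)))
          = (List.range t).map (fun p => (v p, v (p + 1))) := by
        apply List.map_congr_left
        intro p hpt
        rw [List.mem_range] at hpt
        rw [ih p (by omega), ih (p + 1) (by omega)]
      unfold edges at hp
      rw [hsplit, List.map_append, List.map_append, hpre, List.perm_append_left_iff] at hp
      intro e
      have := hp.mem_iff (a := e)
      simp only [List.mem_map, List.mem_range'_1] at this
      constructor
      · rintro ⟨p, a, b, c⟩
        obtain ⟨p', ⟨a, b⟩, c⟩ := this.1 ⟨p, ⟨a, by omega⟩, c⟩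
        exact ⟨p', a, by omega, c⟩
      · rintro ⟨p, a, b, c⟩
        obtain ⟨p', ⟨a, b⟩, c⟩ := this.2 ⟨p, ⟨a, by omega⟩, c⟩
        exact ⟨p', a, by omega, c⟩
    have hut : u t = v t := ih t le_rfl
    obtain ⟨s, hts, hsm, hse⟩ := (hmem (u t, u (t + 1))).1 ⟨t, le_rfl, by omega, rfl⟩
    rw [Prod.mk.injEq] at hse
    obtain ⟨hs1, hs2⟩ := hse
    have hvts : v t = v s := by rw [hs1, hut]
    have hlt : t < s := by
      rcases Nat.lt_or_ge t s with h | h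
      · exact h
      · obtain rfl : s = t := by omega
        exact absurd hs2.symm hne
    have hnext : v (t + 1) ≠ v (s + 1) := by rw [hs2]; exact fun h => hne h.symm
    -- vertices up to `s` are disjoint from those after `s`
    have hdisj : ∀ p h, t ≤ p → p ≤ s → s < h → h ≤ m → v p ≠ v h := by
      intro p h hp1 hp2 hh1 hh2 heq
      apply hnext
      rcases Nat.eq_or_lt_of_le hp1 with rfl | hp1
      · exact h3 t s h hlt hh1 hh2 hvts (by rw [← hvts, heq])
      · rcases Nat.eq_or_lt_of_le hp2 with rfl | hp2
        · exact h3 t p h hlt hh1 hh2 hvts heq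
        · exact h2 t p s h hp1 hp2 hh1 hh2 hvts heq
    -- `u` stays among the late vertices
    have hstay : ∀ d, t + 1 + d ≤ m → ∃ h, s < h ∧ h ≤ m ∧ u (t + 1 + d) = v h := by
      intro d
      induction d with
      | zero => intro _; exact ⟨s + 1, by omega, by omega, hs2.symm⟩
      | succ d ihd =>
        intro hd
        obtain ⟨h, hh1, hh2, hh3⟩ := ihd (by omega)
        obtain ⟨p, hp1, hp2, hp3⟩ :=
          (hmem (u (t + 1 + d), u (t + 1 + d + 1))).1 ⟨t + 1 + d, by omega, by omega, rfl⟩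
        rw [Prod.mk.injEq] at hp3
        have : s < p := by
          by_contra hsp
          exact hdisj p h hp1 (by omega) hh1 hh2 (by rw [hp3.1, hh3])
        exact ⟨p + 1, by omega, by omega, hp3.2.symm⟩
    obtain ⟨p, hp1, hp2, hp3⟩ := (hmem (v t, v (t + 1))).2 ⟨t, le_rfl, by omega, rfl⟩
    rw [Prod.mk.injEq] at hp3
    rcases Nat.eq_or_lt_of_le hp1 with rfl | hp1
    · exact hne hp3.2
    · obtain ⟨h, hh1, hh2, hh3⟩ := hstay (p - (t + 1)) (by omega)
      rw [show t + 1 + (p - (t + 1)) = p by omega] at hh3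
      exact hdisj t h le_rfl hts hh1 hh2 (by rw [← hp3.1, hh3])

lemma kmerCount_eq (k : ℕ) (r x : List Base) :
    kmerCount k r x
      = ((List.range (r.length - k + 1)).map (fun i => (r.drop i).take k)).count x := by
  unfold kmerCount
  rw [List.count, List.countP_map, List.countP_eq_length_filter]
  congr 2
  funext i
  rw [Bool.eq_iff_iff]
  simp

lemma edges_of_kmers (k : ℕ) (hk : 2 ≤ k) (r : List Base) (m : ℕ) :
    ((List.range m).map (fun i => (r.drop i).take k)).map
        (fun w => (w.take (k - 1), w.drop 1))
      = edges (fun i => (r.drop i).take (k - 1)) m := by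
  unfold edges
  rw [List.map_map]
  apply List.map_congr_left
  intro p _
  simp only [Function.comp, List.take_take, List.drop_take, List.drop_drop]
  rw [show min (k - 1) k = k - 1 by omega]

/-- If windows agree at `i`, `j` and the substrings starting with the next letter agree,
then the next windows agree too. -/
lemma next_window (k : ℕ) (hk : 2 ≤ k) (r : List Base) (i j a b : ℕ)
    (h : (r.drop i).take (k - 1) = (r.drop j).take (k - 1))
    (hs : substr r (i + 1 + k - 1) a = substr r (j + 1 + k - 1) b) :
    (r.drop (i + 1)).take (k - 1) = (r.drop (j + 1)).take (k - 1) := by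
  rw [window_eq_iff] at h ⊢
  intro x hx
  rcases Nat.lt_or_ge (x + 1) (k - 1) with hx' | hx'
  · have := h (x + 1) hx'
    rw [show i + 1 + x = i + (x + 1) by omega, show j + 1 + x = j + (x + 1) by omega]
    exact this
  · have := congrArg (fun l : List Base => l[0]?) hs
    simp only [substr, List.getElem?_take, List.getElem?_drop] at this
    rw [if_pos (by omega), if_pos (by omega)] at this
    rw [show i + 1 + x = i + 1 + k - 1 - 1 + 0 by omega,
      show j + 1 + x = j + 1 + k - 1 - 1 + 0 by omega]
    exact this

lemma substr_window (k : ℕ) (hk : 2 ≤ k) (r : List Base) (i : ℕ) :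
    substr r (i + 1) (i + 1 + k - 2) = (r.drop i).take (k - 1) := by
  unfold substr
  rw [show i + 1 - 1 = i by omega, show i + 1 + k - 2 - (i + 1) + 1 = k - 1 by omega]

/-- If `r` satisfies none of the three conditions, then every read of the same length
with the same `k`-mer profile equals `r`. -/
theorem not_conditions_identifiable (k ℓ : ℕ) (hk : 2 ≤ k) (hkl : k ≤ ℓ)
    (r : List Base) (hr : r.length = ℓ)
    (hc1 : ¬ Cond1 k ℓ r) (hc2 : ¬ Cond2 k ℓ r) (hc3 : ¬ Cond3 k ℓ r) :
    ∀ q : List Base, q.length = ℓ →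
      (∀ x : List Base, kmerCount k q x = kmerCount k r x) → q = r := by
  intro q hq hcount
  have hp : (edges (fun i => (q.drop i).take (k - 1)) (ℓ - k + 1)).Perm
      (edges (fun i => (r.drop i).take (k - 1)) (ℓ - k + 1)) := by
    rw [← edges_of_kmers k hk, ← edges_of_kmers k hk]
    apply List.Perm.map
    rw [List.perm_iff_count]
    intro x
    have := hcount x
    rw [kmerCount_eq, kmerCount_eq, hq, hr] at this
    exact this
  suffices hall : ∀ t ≤ ℓ - k + 1, (q.drop t).take (k - 1) = (r.drop t).take (k - 1) by
    apply List.ext_getElem?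
    intro n
    rcases Nat.lt_or_ge n (ℓ - k + 1) with hn | hn
    · exact (window_eq_iff q r n n (k - 1)).1 (hall n (by omega)) 0 (by omega)
    · rcases Nat.lt_or_ge n ℓ with hn' | hn'
      · have := (window_eq_iff q r _ _ (k - 1)).1 (hall (ℓ - k + 1) le_rfl)
          (n - (ℓ - k + 1)) (by omega)
        rwa [show ℓ - k + 1 + (n - (ℓ - k + 1)) = n by omega] at this
      · rw [List.getElem?_eq_none (by omega), List.getElem?_eq_none (by omega)]
  by_cases hend : (r.drop 0).take (k - 1) = (r.drop (ℓ - k + 1)).take (k - 1)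
  · -- constant read
    have hconst : ∀ n < ℓ, r[n]? = r[0]? := by
      intro n hn
      by_contra hne
      apply hc1
      refine ⟨?_, n + 1, by omega, by omega, ?_⟩
      · unfold substr
        rw [show k - 1 - 1 + 1 = k - 1 by omega, show ℓ - (ℓ - k + 2) + 1 = k - 1 by omega]
        exact hend
      · intro h
        apply hne
        have := congrArg (fun l : List Base => l[0]?) h
        simpa [substr, List.getElem?_take] using this
    have hv : ∀ t ≤ ℓ - k + 1, (r.drop t).take (k - 1) = (r.drop 0).take (k - 1) := by
      intro t ht
      rw [window_eq_iff]
      intro x hx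
      rw [hconst (t + x) (by omega), hconst (0 + x) (by omega)]
    have hedge : ∀ p < ℓ - k + 1, (q.drop p).take (k - 1) = (r.drop 0).take (k - 1) ∧
        (q.drop (p + 1)).take (k - 1) = (r.drop 0).take (k - 1) := by
      intro p hpm
      have hmem : ((q.drop p).take (k - 1), (q.drop (p + 1)).take (k - 1)) ∈
          edges (fun i => (r.drop i).take (k - 1)) (ℓ - k + 1) := by
        rw [← hp.mem_iff]
        exact List.mem_map.2 ⟨p, List.mem_range.2 hpm, rfl⟩
      obtain ⟨p', hp', he⟩ := List.mem_map.1 hmem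
      rw [List.mem_range] at hp'
      rw [Prod.mk.injEq] at he
      exact ⟨he.1.symm.trans (hv p' (by omega)), he.2.symm.trans (hv (p' + 1) (by omega))⟩
    intro t ht
    rw [hv t ht]
    rcases Nat.lt_or_ge t (ℓ - k + 1) with h | h
    · exact (hedge t h).1
    · have := (hedge (t - 1) (by omega)).2
      rwa [show t - 1 + 1 = t by omega] at this
  · intro t ht
    refine core (fun i => (q.drop i).take (k - 1)) (fun i => (r.drop i).take (k - 1))
      (ℓ - k + 1) hp (start_eq _ _ _ hp hend) ?_ ?_ t ht t le_rfl
    · intro i g j h hig hgj hjh hhm hij hgh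
      by_contra hne
      apply hc2
      refine ⟨i + 1, g + 1, j + 1, h + 1, by omega, by omega, by omega, by omega, by omega,
        ?_, ?_, ?_⟩
      · rw [substr_window k hk, substr_window k hk]; exact hij
      · rw [substr_window k hk, substr_window k hk]; exact hgh
      · exact fun hs => hne (next_window k hk r i j _ _ hij hs)
    · intro i j h hij' hjh hhm hij hjh'
      by_contra hne
      apply hc3
      refine ⟨i + 1, j + 1, h + 1, by omega, by omega, by omega, by omega, ?_, ?_, ?_⟩
      · rw [substr_window k hk, substr_window k hk]; exact hij
      · rw [substr_window k hk, substr_window k hk]; exact hjh'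
      · exact fun hs => hne (next_window k hk r i j _ _ hij hs)
end

section
/- Let r = r₁⋯r_ℓ be a read of length ℓ and 2 ≤ k ≤ ℓ, and suppose that for some i* ∈ {1,…,ℓ−k+2} every (k−1)-mer x_i = r_i⋯r_{i+k−2} with 1 ≤ i ≤ i* occurs exactly once in r (i.e., c_r(x_i) = 1 where c_r here counts occurrences of (k−1)-mers). If q = q₁⋯q_ℓ is a read of length ℓ having the same k-mer profile as r, then r_i = q_i for all 1 ≤ i ≤ i* + k − 2. -/
theorem kmer_exists (k : ℕ) (r q : List Base)
    (hprof : ∀ x : List Base, kmerCount k q x = kmerCount k r x) (j : ℕ)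
    (hj : j < r.length - k + 1) :
    ∃ i, i < q.length - k + 1 ∧ (q.drop i).take k = (r.drop j).take k := by
  have h := hprof ((r.drop j).take k)
  have hpos : 0 < kmerCount k r ((r.drop j).take k) := by
    unfold kmerCount
    apply List.length_pos_of_mem (a := j)
    simp only [List.mem_filter, List.mem_range, decide_eq_true_eq]
    exact ⟨hj, trivial⟩
  rw [← h] at hpos
  unfold kmerCount at hpos
  obtain ⟨i, hi⟩ := List.exists_mem_of_length_pos hpos
  simp only [List.mem_filter, List.mem_range, decide_eq_true_eq] at hi
  exact ⟨i, hi⟩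

theorem kmer_unique (m : ℕ) (r x : List Base) (h : kmerCount m r x = 1) (a b : ℕ)
    (ha : a < r.length - m + 1) (hb : b < r.length - m + 1)
    (hax : (r.drop a).take m = x) (hbx : (r.drop b).take m = x) : a = b := by
  unfold kmerCount at h
  obtain ⟨c, hc⟩ := List.length_eq_one_iff.1 h
  have h1 : a ∈ [c] := by
    rw [← hc]; simp only [List.mem_filter, List.mem_range, decide_eq_true_eq]; exact ⟨ha, hax⟩
  have h2 : b ∈ [c] := by
    rw [← hc]; simp only [List.mem_filter, List.mem_range, decide_eq_true_eq]; exact ⟨hb, hbx⟩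
  rw [List.mem_singleton] at h1 h2
  rw [h1, h2]

theorem take_pre {a b : List Base} {m : ℕ} (h : a.take (m + 1) = b.take (m + 1)) :
    a.take m = b.take m := by
  have := congrArg (List.take m) h
  simpa [List.take_take] using this

theorem take_suf {r q : List Base} {a b m : ℕ}
    (h : (q.drop a).take (m + 1) = (r.drop b).take (m + 1)) :
    (q.drop (a + 1)).take m = (r.drop (b + 1)).take m := by
  have := congrArg (List.drop 1) h
  simpa [List.drop_take, List.drop_drop] using this

/-- If every (k−1)-mer of `r` starting at a position `i ≤ i*` occurs exactly once in `r`,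
then any read `q` of the same length with the same `k`-mer profile agrees with `r` on the
first `i* + k − 2` positions. -/
theorem prefix_agreement_of_unique_kmers (k ℓ istar : ℕ) (hk : 2 ≤ k) (hkl : k ≤ ℓ)
    (histar : 1 ≤ istar) (histar' : istar ≤ ℓ - k + 2)
    (r : List Base) (hr : r.length = ℓ)
    (huniq : ∀ i, 1 ≤ i → i ≤ istar → kmerCount (k - 1) r (substr r i (i + k - 2)) = 1)
    (q : List Base) (hq : q.length = ℓ)
    (hprof : ∀ x : List Base, kmerCount k q x = kmerCount k r x) :
    ∀ i, 1 ≤ i → i ≤ istar + k - 2 → substr r i i = substr q i i := by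
  obtain ⟨m, rfl⟩ : ∃ m, k = m + 1 := ⟨k - 1, by omega⟩
  have hu : ∀ i, i < istar → kmerCount m r ((r.drop i).take m) = 1 := by
    intro i hi
    have h := huniq (i + 1) (by omega) (by omega)
    unfold substr at h
    have e : i + 1 + (m + 1) - 2 - (i + 1) + 1 = m := by omega
    rw [e] at h
    simpa using h
  have key : ∀ i, i < istar → (q.drop i).take m = (r.drop i).take m := by
    intro i
    induction i with
    | zero =>
      intro h0
      obtain ⟨j, hj, hje⟩ := kmer_exists (m + 1) r q hprof 0 (by omega)
      rcases j with _ | j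
      · exact take_pre hje
      · exfalso
        obtain ⟨j', hj', hje'⟩ :=
          kmer_exists (m + 1) q r (fun x => (hprof x).symm) j (by omega)
        have h1 := (take_suf hje').trans (take_pre hje)
        have := kmer_unique m r _ (hu 0 h0) (j' + 1) 0 (by omega) (by omega) h1 rfl
        omega
    | succ i ih =>
      intro hi
      have hi' := ih (by omega)
      obtain ⟨j, hj, hje⟩ :=
        kmer_exists (m + 1) q r (fun x => (hprof x).symm) i (by omega)
      have h1 := (take_pre hje).trans hi'
      have := kmer_unique m r _ (hu i (by omega)) j i (by omega) (by omega) h1 rfl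
      subst this
      exact (take_suf hje).symm
  intro i hi1 hi2
  obtain ⟨a, b, hab, ha, hb⟩ : ∃ a b, i - 1 = a + b ∧ a < istar ∧ b + 1 ≤ m := by
    by_cases h : i - 1 < istar
    · exact ⟨i - 1, 0, by omega, h, by omega⟩
    · exact ⟨istar - 1, i - 1 - (istar - 1), by omega, by omega, by omega⟩
  have h := congrArg (fun l => (l.drop b).take 1) (key a ha)
  simp only [List.drop_take, List.drop_drop, List.take_take] at h
  have e : min 1 (m - b) = 1 := by omega
  rw [e] at h
  unfold substr
  rw [hab, Nat.sub_self]
  exact h.symm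
end

section
/- Let r = r₁⋯r_ℓ be a read of length ℓ and 2 ≤ k ≤ ℓ, and suppose that the (k−1)-mer r_1⋯r_{k−1} occurs exactly once in r (as a contiguous substring). If q = q₁⋯q_ℓ is a read of length ℓ having the same k-mer profile as r, then the initial k-mers of q and r coincide: q_1⋯q_k = r_1⋯r_k. -/
theorem kmer_mem_of_profile (k : ℕ) (p q : List Base) (hlen : p.length = q.length)
    (hprof : ∀ x : List Base, kmerCount k p x = kmerCount k q x)
    (i : ℕ) (hi : i < p.length - k + 1) :
    ∃ j, j < p.length - k + 1 ∧ (q.drop j).take k = (p.drop i).take k := by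
  have h := hprof ((p.drop i).take k)
  have h1 : 0 < kmerCount k p ((p.drop i).take k) := by
    unfold kmerCount
    apply List.length_pos_of_mem (a := i)
    simp [List.mem_filter, hi]
  rw [h] at h1
  unfold kmerCount at h1
  obtain ⟨j, hj⟩ := List.exists_mem_of_length_pos h1
  simp only [List.mem_filter, List.mem_range, decide_eq_true_eq] at hj
  exact ⟨j, by rw [hlen]; exact hj.1, hj.2⟩

theorem tail_kmer (k : ℕ) (l : List Base) (i : ℕ) :
    ((l.drop i).take (k + 1)).drop 1 = (l.drop (i + 1)).take k := by
  rw [List.drop_take, List.drop_drop]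
  simp

theorem init_kmer (k : ℕ) (l : List Base) (i : ℕ) :
    ((l.drop i).take (k + 1)).take k = (l.drop i).take k := by
  rw [List.take_take]
  simp

/-- If the first (k−1)-mer of `r` occurs exactly once in `r`, then any read `q` of the
same length with the same `k`-mer profile starts with the same `k`-mer as `r`. -/
theorem first_kmer_agreement (k ℓ : ℕ) (hk : 2 ≤ k) (hkl : k ≤ ℓ)
    (r : List Base) (hr : r.length = ℓ)
    (huniq : kmerCount (k - 1) r (substr r 1 (k - 1)) = 1)
    (q : List Base) (hq : q.length = ℓ)
    (hprof : ∀ x : List Base, kmerCount k q x = kmerCount k r x) :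
    substr q 1 k = substr r 1 k := by
  obtain ⟨m, rfl⟩ : ∃ m, k = m + 1 := ⟨k - 1, by omega⟩
  have hm : m - 1 + 1 = m := by omega
  simp only [substr, Nat.add_sub_cancel, Nat.sub_self, hm] at huniq ⊢
  obtain ⟨i, hi, hir⟩ := kmer_mem_of_profile (m + 1) r q (by omega)
    (fun x => (hprof x).symm) 0 (by omega)
  rcases i with _ | i
  · exact hir
  · exfalso
    obtain ⟨j, hj, hjq⟩ := kmer_mem_of_profile (m + 1) q r (by omega) hprof i (by omega)
    have e1 : (r.drop (j + 1)).take m = (r.drop 0).take m := by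
      rw [← tail_kmer, hjq, tail_kmer, ← init_kmer, hir, init_kmer]
    unfold kmerCount at huniq
    obtain ⟨a, ha⟩ := List.length_eq_one_iff.mp huniq
    have m0 : 0 ∈ [a] := by
      rw [← ha]
      simp [List.mem_filter]
    have m1 : j + 1 ∈ [a] := by
      rw [← ha]
      simp only [List.mem_filter, List.mem_range, decide_eq_true_eq]
      exact ⟨by omega, e1⟩
    simp only [List.mem_singleton] at m0 m1
    omega
end

section
/- Let r be a read of length ℓ and 2 ≤ k ≤ ℓ. If every (k−1)-mer occurring in r (as a contiguous substring) occurs at most once in r, then there exists no read of length ℓ distinct from r having the same k-mer profile as r. -/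
theorem kmer_window_iff (k : ℕ) (a b : List Base) (i j : ℕ) :
    (a.drop i).take k = (b.drop j).take k ↔ ∀ t < k, a[i + t]? = b[j + t]? := by
  constructor
  · intro h t ht
    have := congrArg (fun l => l[t]?) h
    simpa [List.getElem?_take, ht] using this
  · intro h
    apply List.ext_getElem?
    intro t
    by_cases ht : t < k
    · simpa [List.getElem?_take, ht] using h t ht
    · simp [List.getElem?_take, ht]

/-- If every (k−1)-mer occurs at most once in `r`, then no distinct read of the same
length has the same `k`-mer profile as `r`. -/
theorem identifiable_of_unique_km1mers (k ℓ : ℕ) (hk : 2 ≤ k) (hkl : k ≤ ℓ)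
    (r : List Base) (hr : r.length = ℓ)
    (huniq : ∀ x : List Base, x.length = k - 1 → kmerCount (k - 1) r x ≤ 1) :
    ¬ ∃ q : List Base, q.length = ℓ ∧ q ≠ r ∧
      (∀ x : List Base, kmerCount k q x = kmerCount k r x) := by
  rintro ⟨q, hq, hne, hc⟩
  apply hne
  have inj : ∀ i j, i ≤ ℓ - k + 1 → j ≤ ℓ - k + 1 →
      (∀ t < k - 1, r[i + t]? = r[j + t]?) → i = j := by
    intro i j hi hj h
    have h1 := huniq ((r.drop j).take (k - 1)) (by simp; omega)
    unfold kmerCount at h1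
    have mi : i ∈ (List.range (r.length - (k - 1) + 1)).filter
        (fun i => decide ((r.drop i).take (k - 1) = (r.drop j).take (k - 1))) := by
      simp only [List.mem_filter, List.mem_range, decide_eq_true_eq]
      exact ⟨by omega, (kmer_window_iff _ _ _ _ _).2 h⟩
    have mj : j ∈ (List.range (r.length - (k - 1) + 1)).filter
        (fun i => decide ((r.drop i).take (k - 1) = (r.drop j).take (k - 1))) := by
      simp only [List.mem_filter, List.mem_range, decide_eq_true_eq]
      exact ⟨by omega, trivial⟩
    generalize (List.range (r.length - (k - 1) + 1)).filter
        (fun i => decide ((r.drop i).take (k - 1) = (r.drop j).take (k - 1))) = l at *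
    match l, h1, mi, mj with
    | [a], _, mi, mj => simp at mi mj; omega
  have ex : ∀ j, ∃ i, j < ℓ - k + 1 → i < ℓ - k + 1 ∧ ∀ t < k, q[j + t]? = r[i + t]? := by
    intro j
    by_cases hj : j < ℓ - k + 1
    · have h1 := hc ((q.drop j).take k)
      have h2 : 0 < kmerCount k q ((q.drop j).take k) := by
        unfold kmerCount
        apply List.length_pos_of_mem (a := j)
        simp only [List.mem_filter, List.mem_range, decide_eq_true_eq]
        exact ⟨by omega, trivial⟩
      rw [h1] at h2
      unfold kmerCount at h2
      obtain ⟨i, hi⟩ := List.exists_mem_of_length_pos h2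
      simp only [List.mem_filter, List.mem_range, decide_eq_true_eq] at hi
      exact ⟨i, fun _ => ⟨by omega, (kmer_window_iff _ _ _ _ _).1 hi.2.symm⟩⟩
    · exact ⟨0, fun h => absurd h hj⟩
  choose p hp using ex
  have step : ∀ j, j < ℓ - k + 1 → p j = p 0 + j := by
    intro j
    induction j with
    | zero => simp
    | succ j ih =>
      intro hj
      have ih := ih (by omega)
      obtain ⟨a1, a2⟩ := hp j (by omega)
      obtain ⟨b1, b2⟩ := hp (j + 1) hj
      have := inj (p (j + 1)) (p j + 1) (by omega) (by omega) (by
        intro t ht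
        rw [← b2 t (by omega), show p j + 1 + t = p j + (t + 1) by omega,
          ← a2 (t + 1) (by omega), show j + 1 + t = j + (t + 1) by omega])
      omega
  have h0 : p 0 = 0 := by
    have h1 := step (ℓ - k) (by omega)
    have h2 := (hp (ℓ - k) (by omega)).1
    omega
  apply List.ext_getElem?
  intro m
  by_cases hm : m < ℓ
  · have hj : min m (ℓ - k) < ℓ - k + 1 := by omega
    have h1 := (hp _ hj).2 (m - min m (ℓ - k)) (by omega)
    rw [step _ hj, h0, Nat.zero_add,
      show min m (ℓ - k) + (m - min m (ℓ - k)) = m by omega] at h1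
    exact h1
  · rw [List.getElem?_eq_none (by omega), List.getElem?_eq_none (by omega)]
end

section
/- Let k ≥ 2 and let c be a string over Σ of length n ≥ k. For a string s of length ≥ k−1, let L(s) denote the read obtained by appending to s its own first k−1 letters, i.e., L(s) = s ++ (prefix of s of length k−1). Then for every rotation c' of c (obtained by moving any number of letters from the front of c to its end), the reads L(c) and L(c') have the same k-mer profile. -/
/-- `linearize k s` appends to `s` its own first `k − 1` letters. -/
def linearize (k : ℕ) (s : List Base) : List Base :=
  s ++ s.take (k - 1)

theorem window_eq (k : ℕ) (c : List Base) (hk : 2 ≤ k) (hc : k ≤ c.length) (i : ℕ) (hi : i < c.length) :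
    ((linearize k c).drop i).take k = (c.rotate i).take k := by
  unfold linearize
  rw [List.rotate_eq_drop_append_take hi.le, List.drop_append_of_le_length hi.le]
  apply List.ext_getElem?
  intro j
  simp only [List.getElem?_take, List.getElem?_append, List.length_drop, List.getElem?_drop]
  split_ifs <;> first | rfl | omega

theorem kmerCount_linearize (k : ℕ) (c x : List Base) (hk : 2 ≤ k) (hc : k ≤ c.length) :
    kmerCount k (linearize k c) x = Nat.count (fun i => (c.rotate i).take k = x) c.length := by
  have hl : (linearize k c).length - k + 1 = c.length := by
    simp only [linearize, List.length_append, List.length_take]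
    omega
  unfold kmerCount
  rw [hl, Nat.count_eq_card_filter_range]
  have : (List.range c.length).filter (fun i => decide (((linearize k c).drop i).take k = x))
      = (List.range c.length).filter (fun i => decide ((c.rotate i).take k = x)) := by
    apply List.filter_congr
    intro i hi
    rw [window_eq k c hk hc i (List.mem_range.1 hi)]
  rw [this]
  rfl

/-- For any rotation `c'` of `c`, the reads `L(c)` and `L(c')` obtained by appending
to each string its own first `k − 1` letters have the same `k`-mer profile. -/
theorem rotation_same_kmer_profile (k : ℕ) (hk : 2 ≤ k) (c : List Base)
    (hc : k ≤ c.length) (t : ℕ) :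
    ∀ x : List Base, kmerCount k (linearize k c) x = kmerCount k (linearize k (c.rotate t)) x := by
  intro x
  have hp : Function.Periodic (fun i => (c.rotate i).take k = x) c.length := by
    intro i
    simp only
    rw [← List.rotate_mod c (i + c.length), Nat.add_mod_right, List.rotate_mod]
  have h := Nat.filter_Ico_card_eq_of_periodic t c.length _ hp
  rw [kmerCount_linearize k c x hk hc,
    kmerCount_linearize k (c.rotate t) x hk (by simpa using hc), ← h, List.length_rotate,
    Nat.count_eq_card_filter_range]
  symm
  apply Finset.card_bij (fun i _ => t + i)
  · intro i hi
    simp only [Finset.mem_filter, Finset.mem_range, Finset.mem_Ico, List.rotate_rotate] at hi ⊢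
    exact ⟨by omega, hi.2⟩
  · intro i _ j _ hij
    omega
  · intro i hi
    simp only [Finset.mem_filter, Finset.mem_Ico] at hi
    refine ⟨i - t, ?_, by omega⟩
    simp only [Finset.mem_filter, Finset.mem_range, List.rotate_rotate]
    rw [show t + (i - t) = i by omega]
    exact ⟨by omega, hi.2⟩
end

section
/- Let k ≥ 2, let x and y be strings over Σ of length k−1, and let A, S₁, V, S₂, W be arbitrary (possibly empty) strings over Σ. Then the two reads r = A·x·S₁·y·V·x·S₂·y·W and r' = A·x·S₂·y·V·x·S₁·y·W (where · denotes concatenation) have the same length and the same k-mer profile. -/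
/-- Recursive count of the occurrences of `z` as a window of length `k`. -/
def windowCount (k : ℕ) (z : List Base) : List Base → ℕ
  | [] => 0
  | a :: l => (if k ≤ (a :: l).length ∧ (a :: l).take k = z then 1 else 0) + windowCount k z l

theorem windowCount_short (k : ℕ) (z : List Base) (l : List Base) (h : l.length < k) :
    windowCount k z l = 0 := by
  induction l with
  | nil => rfl
  | cons a l ih =>
    have h2 : ¬ k ≤ (a :: l).length := by omega
    simp only [List.length_cons] at h
    rw [windowCount, ih (by omega), if_neg (fun h3 => h2 h3.1)]

theorem windowCount_split (k : ℕ) (hk : 1 ≤ k) (z P u Q : List Base) (hu : u.length = k - 1) :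
    windowCount k z (P ++ (u ++ Q)) = windowCount k z (P ++ u) + windowCount k z (u ++ Q) := by
  induction P with
  | nil =>
    have := windowCount_short k z u (by omega)
    simp [this]
  | cons a P ih =>
    have h1 : k ≤ (a :: (P ++ u)).length := by simp; omega
    have h2 : k ≤ (a :: (P ++ (u ++ Q))).length := by simp; omega
    have h3 : (a :: (P ++ (u ++ Q))).take k = (a :: (P ++ u)).take k := by
      have : a :: (P ++ (u ++ Q)) = (a :: (P ++ u)) ++ Q := by simp
      rw [this, List.take_append_of_le_length h1]
    simp only [List.cons_append, windowCount]
    rw [ih, h3]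
    simp only [h1, h2, true_and]
    omega

theorem windowCount_eq (k : ℕ) (hk : 1 ≤ k) (z r : List Base) :
    ((List.range (r.length + 1 - k)).filter
      (fun i => decide ((r.drop i).take k = z))).length = windowCount k z r := by
  induction r with
  | nil =>
    have : ([] : List Base).length + 1 - k = 0 := by simp; omega
    rw [this]; rfl
  | cons a l ih =>
    by_cases h : k ≤ (a :: l).length
    · have e : (a :: l).length + 1 - k = (l.length + 1 - k) + 1 := by
        simp only [List.length_cons] at h ⊢; omega
      rw [e, List.range_succ_eq_map, windowCount, ← ih, ← List.countP_eq_length_filter,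
        ← List.countP_eq_length_filter, List.countP_cons, List.countP_map]
      simp only [h, true_and, List.drop_zero, decide_eq_true_eq]
      rw [add_comm]
      rfl
    · have e : (a :: l).length + 1 - k = 0 := by omega
      rw [e, windowCount_short k z _ (by omega)]; rfl

theorem kmerCount_eq_windowCount (k : ℕ) (hk : 1 ≤ k) (z r : List Base) (h : k ≤ r.length) :
    kmerCount k r z = windowCount k z r := by
  rw [← windowCount_eq k hk, kmerCount, show r.length - k + 1 = r.length + 1 - k by omega]

theorem windowCount_five (k : ℕ) (hk : 1 ≤ k) (z x y A S V T W : List Base)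
    (hx : x.length = k - 1) (hy : y.length = k - 1) :
    windowCount k z (A ++ x ++ S ++ y ++ V ++ x ++ T ++ y ++ W) =
      windowCount k z (A ++ x) + (windowCount k z (x ++ S ++ y) + (windowCount k z (y ++ V ++ x) +
        (windowCount k z (x ++ T ++ y) + windowCount k z (y ++ W)))) := by
  have e : A ++ x ++ S ++ y ++ V ++ x ++ T ++ y ++ W
      = A ++ (x ++ (S ++ (y ++ (V ++ (x ++ (T ++ (y ++ W))))))) := by simp
  rw [e, windowCount_split k hk z A x _ hx, ← List.append_assoc x S,
    windowCount_split k hk z (x ++ S) y _ hy, ← List.append_assoc y V,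
    windowCount_split k hk z (y ++ V) x _ hx, ← List.append_assoc x T,
    windowCount_split k hk z (x ++ T) y _ hy]

/-- Swapping the two segments lying between the repeated (k−1)-mers `x` and `y`
preserves the length and the `k`-mer profile. -/
theorem swap_between_two_repeats_same_profile (k : ℕ) (hk : 2 ≤ k)
    (x y A S₁ V S₂ W : List Base) (hx : x.length = k - 1) (hy : y.length = k - 1) :
    (A ++ x ++ S₁ ++ y ++ V ++ x ++ S₂ ++ y ++ W).length
        = (A ++ x ++ S₂ ++ y ++ V ++ x ++ S₁ ++ y ++ W).length ∧
      ∀ z : List Base,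
        kmerCount k (A ++ x ++ S₁ ++ y ++ V ++ x ++ S₂ ++ y ++ W) z
          = kmerCount k (A ++ x ++ S₂ ++ y ++ V ++ x ++ S₁ ++ y ++ W) z := by
  have hl : (A ++ x ++ S₁ ++ y ++ V ++ x ++ S₂ ++ y ++ W).length
        = (A ++ x ++ S₂ ++ y ++ V ++ x ++ S₁ ++ y ++ W).length := by
    simp only [List.length_append]; omega
  have hl2 : k ≤ (A ++ x ++ S₁ ++ y ++ V ++ x ++ S₂ ++ y ++ W).length := by
    simp only [List.length_append]; omega
  refine ⟨hl, fun z => ?_⟩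
  rw [kmerCount_eq_windowCount k (by omega) z _ hl2,
    kmerCount_eq_windowCount k (by omega) z _ (hl ▸ hl2),
    windowCount_five k (by omega) z x y _ _ _ _ _ hx hy,
    windowCount_five k (by omega) z x y _ _ _ _ _ hx hy]
  omega
end

section
/- Let 1 ≤ k ≤ ℓ and let r, q be identifiable reads of length ℓ. Then (1/ℓ)·d_H(r, q) ≤ ‖c_r − c_q‖₁ ≤ k·|Σ|^k·d_H(r, q), where |Σ| = 4; that is, the map sending an identifiable read to its k-mer profile is a Lipschitz equivalence between the space of identifiable reads of length ℓ with the Hamming distance and its image in ℕ^{|Σ|^k} with the ℓ₁ distance, with constants α_l = 1/ℓ and α_u = k·|Σ|^k. -/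
/-- Hamming distance between two reads of the same length: the number of positions
at which they differ. -/
def hamming (r q : List Base) : ℕ :=
  ((List.range r.length).filter (fun i => decide (r.getD i 0 ≠ q.getD i 0))).length

/-- The ℓ₁ distance `‖c_r − c_q‖₁ = ∑_{x ∈ Σ^k} |c_r(x) − c_q(x)|` between the
`k`-mer profiles of `r` and `q`. -/
def l1dist (k : ℕ) (r q : List Base) : ℕ :=
  ∑ x : Fin k → Base,
    ((kmerCount k r (List.ofFn x) : ℤ) - (kmerCount k q (List.ofFn x) : ℤ)).natAbs

/-- A read `r` of length `ℓ` is identifiable (for a given `k`) if no distinct read of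
length `ℓ` has the same `k`-mer profile. -/
def Identifiable (k ℓ : ℕ) (r : List Base) : Prop :=
  r.length = ℓ ∧ ∀ q : List Base, q.length = ℓ →
    (∀ x : List Base, kmerCount k q x = kmerCount k r x) → q = r

lemma kmerCount_eq_card (k : ℕ) (r x : List Base) :
    kmerCount k r x
      = ((Finset.range (r.length - k + 1)).filter (fun i => (r.drop i).take k = x)).card := by
  unfold kmerCount
  rfl

lemma hamming_eq_card (r q : List Base) :
    hamming r q
      = ((Finset.range r.length).filter (fun i => r.getD i 0 ≠ q.getD i 0)).card := by
  unfold hamming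
  rfl

lemma hamming_comm_of_length (r q : List Base) (h : r.length = q.length) :
    hamming r q = hamming q r := by
  unfold hamming
  rw [h]
  simp only [ne_comm]

/-- If two windows differ then the reads differ at a position inside the window. -/
lemma exists_diff (k : ℕ) (r q : List Base) (h : r.length = q.length) (i : ℕ)
    (hne : (r.drop i).take k ≠ (q.drop i).take k) :
    ∃ j < k, i + j < r.length ∧ r.getD (i + j) 0 ≠ q.getD (i + j) 0 := by
  by_contra! hcon
  apply hne
  apply List.ext_getElem
  · simp [h]
  · intro j h1 h2
    simp only [List.length_take, List.length_drop, lt_min_iff] at h1 h2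
    have := hcon j h1.1 (by omega)
    rw [List.getD_eq_getElem _ _ (by omega), List.getD_eq_getElem _ _ (by omega)] at this
    simpa using this

lemma kmerCount_le (k : ℕ) (r q x : List Base) (h : r.length = q.length) :
    kmerCount k r x ≤ kmerCount k q x + k * hamming r q := by
  rw [kmerCount_eq_card, kmerCount_eq_card, hamming_eq_card, ← h]
  set D := (Finset.range r.length).filter (fun i => r.getD i 0 ≠ q.getD i 0) with hD
  have hsub : (Finset.range (r.length - k + 1)).filter (fun i => (r.drop i).take k = x) ⊆
      (Finset.range (r.length - k + 1)).filter (fun i => (q.drop i).take k = x) ∪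
        (Finset.range k ×ˢ D).image (fun p => p.2 - p.1) := by
    intro i hi
    rw [Finset.mem_filter] at hi
    rw [Finset.mem_union]
    by_cases hx : (q.drop i).take k = x
    · left
      exact Finset.mem_filter.2 ⟨hi.1, hx⟩
    · right
      obtain ⟨j, hj, hl, hne⟩ := exists_diff k r q h i (by rw [hi.2]; exact fun e => hx e.symm)
      refine Finset.mem_image.2 ⟨(j, i + j), ?_, by simp⟩
      rw [Finset.mem_product]
      exact ⟨Finset.mem_range.2 hj, Finset.mem_filter.2 ⟨Finset.mem_range.2 hl, hne⟩⟩
  refine (Finset.card_le_card hsub).trans ((Finset.card_union_le _ _).trans ?_)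
  gcongr
  refine Finset.card_image_le.trans ?_
  simp [Finset.card_product]

lemma kmerCount_eq_zero (k : ℕ) (r x : List Base) (hk : k ≤ r.length) (hx : x.length ≠ k) :
    kmerCount k r x = 0 := by
  rw [kmerCount_eq_card, Finset.card_eq_zero, Finset.filter_eq_empty_iff]
  intro i hi e
  rw [Finset.mem_range] at hi
  apply hx
  rw [← e, List.length_take, List.length_drop]
  omega

lemma l1dist_le (k : ℕ) (r q : List Base) (h : r.length = q.length) :
    l1dist k r q ≤ k * 4 ^ k * hamming r q := by
  unfold l1dist
  have : ∀ x ∈ (Finset.univ : Finset (Fin k → Base)),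
      ((kmerCount k r (List.ofFn x) : ℤ) - (kmerCount k q (List.ofFn x) : ℤ)).natAbs
        ≤ k * hamming r q := by
    intro x _
    have h1 := kmerCount_le k r q (List.ofFn x) h
    have h2 := kmerCount_le k q r (List.ofFn x) h.symm
    rw [← hamming_comm_of_length r q h] at h2
    generalize k * hamming r q = m at *
    omega
  refine (Finset.sum_le_card_nsmul _ _ _ this).trans (le_of_eq ?_)
  simp
  ring

lemma hamming_le_length (r q : List Base) : hamming r q ≤ r.length := by
  rw [hamming_eq_card]
  exact (Finset.card_filter_le _ _).trans (by simp)

lemma hamming_self (r : List Base) : hamming r r = 0 := by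
  simp [hamming]

lemma eq_of_l1dist_eq_zero (k ℓ : ℕ) (hkl : k ≤ ℓ) (r q : List Base)
    (hr : Identifiable k ℓ r) (hq : q.length = ℓ) (h0 : l1dist k r q = 0) : q = r := by
  apply hr.2 q hq
  intro x
  by_cases hx : x.length = k
  · subst hx
    unfold l1dist at h0
    rw [Finset.sum_eq_zero_iff] at h0
    have := h0 x.get (Finset.mem_univ _)
    rw [List.ofFn_get] at this
    omega
  · rw [kmerCount_eq_zero k q x (by omega) hx,
      kmerCount_eq_zero k r x (by rw [hr.1]; exact hkl) hx]

/-- On identifiable reads of length `ℓ`, the `k`-mer profile map is a Lipschitz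
equivalence between the Hamming distance and the ℓ₁ distance on profiles, with
constants `α_l = 1/ℓ` and `α_u = k·|Σ|^k = k·4^k`. -/
theorem kmer_profile_lipschitz_equivalence (k ℓ : ℕ) (hk : 1 ≤ k) (hkl : k ≤ ℓ)
    (r q : List Base) (hr : Identifiable k ℓ r) (hq : Identifiable k ℓ q) :
    (1 / (ℓ : ℝ)) * (hamming r q : ℝ) ≤ (l1dist k r q : ℝ) ∧
      (l1dist k r q : ℝ) ≤ (k : ℝ) * (4 : ℝ) ^ k * (hamming r q : ℝ) := by
  have hlen : r.length = q.length := hr.1.trans hq.1.symm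
  constructor
  · have hl : (0 : ℝ) < ℓ := by exact_mod_cast (by omega : 0 < ℓ)
    rw [one_div, inv_mul_le_iff₀ hl]
    norm_cast
    by_cases h0 : l1dist k r q = 0
    · have := eq_of_l1dist_eq_zero k ℓ hkl r q hr hq.1 h0
      subst this
      simp [hamming_self]
    · have h1 := hamming_le_length r q
      rw [hr.1] at h1
      exact h1.trans (Nat.le_mul_of_pos_right _ (Nat.pos_of_ne_zero h0))
  · exact_mod_cast l1dist_le k r q hlen
end
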